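/- For every k ≥ 1, every parity decision tree that computes the recursive majority function MAJ₃^⊗k : {-1,1}^{3^k} → {-1,1} has depth at least (9/4)^k / (4·ln 2); in particular the parity decision tree depth of MAJ₃^⊗k is Ω(2.25^k). -/

import Mathlib

open Finset

/-- The ±1 sign value of a boolean: `true ↦ 1`, `false ↦ -1`. -/
def bsign (b : Bool) : ℝ := if b then 1 else -1

/-- The parity character `χ_S(x) = ∏_{i ∈ S} x_i` (with `x_i = ±1`), as an integer. -/
def chi {n : ℕ} (S : Finset (Fin n)) (x : Fin n → Bool) : ℤ :=
  ∏ i ∈ S, (if x i then 1 else -1)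

/-- Parity decision trees on `n` variables, with leaves labelled in `{-1,1}`
(encoded as `Bool`, `true ↦ 1`, `false ↦ -1`).  At an internal node labelled `S`,
an input `x` follows the edge labelled `χ_S(x)`: the `tpos` child if `χ_S(x) = 1`
and the `tneg` child if `χ_S(x) = -1`. -/
inductive PDT (n : ℕ) : Type where
  | leaf (b : Bool) : PDT n
  | node (S : Finset (Fin n)) (tneg tpos : PDT n) : PDT n

namespace PDT

variable {n : ℕ}

/-- The depth of the tree: maximum number of internal nodes on a root-to-leaf path. -/
def depth : PDT n → ℕ
  | leaf _ => 0
  | node _ t0 t1 => max (depth t0) (depth t1) + 1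

/-- The label of the leaf reached by input `x`. -/
def eval : PDT n → (Fin n → Bool) → Bool
  | leaf b, _ => b
  | node S t0 t1, x => if chi S x = 1 then eval t1 x else eval t0 x

/-- The identity of the leaf reached by input `x`, recorded as the sequence of
branches taken along the root-to-leaf path. -/
def leafId : PDT n → (Fin n → Bool) → List Bool
  | leaf _, _ => []
  | node S t0 t1, x =>
      if chi S x = 1 then true :: leafId t1 x else false :: leafId t0 x

/-- Number of internal nodes on the root-to-leaf path followed by input `x`. -/
def depthOn : PDT n → (Fin n → Bool) → ℕ
  | leaf _, _ => 0
  | node S t0 t1, x =>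
      (if chi S x = 1 then depthOn t1 x else depthOn t0 x) + 1

/-- `T` computes `f` if every input reaches a leaf labelled `f x`. -/
def Computes (T : PDT n) (f : (Fin n → Bool) → Bool) : Prop :=
  ∀ x, T.eval x = f x

/-- The vector `ℓ ∈ {-1,0,1}^n` associated to the leaf reached by `x`:
`ℓ i` is the average of the `i`-th coordinate (as a `±1` value) over the
uniform distribution on inputs reaching that leaf. -/
noncomputable def leafVec (T : PDT n) (x : Fin n → Bool) (i : Fin n) : ℝ :=
  (∑ y : Fin n → Bool, if T.leafId y = T.leafId x then bsign (y i) else 0) /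
    ((Finset.univ.filter fun y : Fin n → Bool => T.leafId y = T.leafId x).card)

/-- A boolean-valued function `φ` of the input is fixed by the path to the leaf
reached by `x` if it is constant on the set of inputs reaching that leaf. -/
def FixedAt (T : PDT n) (x : Fin n → Bool) (φ : (Fin n → Bool) → Bool) : Prop :=
  ∀ y z : Fin n → Bool, T.leafId y = T.leafId x → T.leafId z = T.leafId x → φ y = φ z

/-- `T` is (pairwise) correlation-free: along any root-to-leaf path, whenever
`x_i ⊕ x_j` (for `i ≠ j`) is fixed, both `x_i` and `x_j` are fixed. -/
def CorrelationFree (T : PDT n) : Prop :=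
  ∀ i j : Fin n, i ≠ j → ∀ x : Fin n → Bool,
    FixedAt T x (fun y => xor (y i) (y j)) →
    FixedAt T x (fun y => y i) ∧ FixedAt T x (fun y => y j)

/-- `T'` refines `T`: the set of inputs reaching any given leaf of `T'` is
contained in the set of inputs reaching some leaf of `T`. -/
def Refines (T' T : PDT n) : Prop :=
  ∀ y z : Fin n → Bool, T'.leafId y = T'.leafId z → T.leafId y = T.leafId z

/-- An ordinary decision tree: every internal node queries a single coordinate. -/
def Ordinary : PDT n → Prop
  | leaf _ => True
  | node S t0 t1 => (∃ i : Fin n, S = {i}) ∧ Ordinary t0 ∧ Ordinary t1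

end PDT

/-- The linear Fourier coefficient `f̂(i) = E_x[f(x)·x_i]` over uniform `x ∈ {-1,1}^n`. -/
noncomputable def fhat {n : ℕ} (f : (Fin n → Bool) → Bool) (i : Fin n) : ℝ :=
  (∑ x : Fin n → Bool, bsign (f x) * bsign (x i)) / 2 ^ n

/-- The index of coordinate `j` of the `i`-th block of `n` consecutive coordinates. -/
def blockIdx {m n : ℕ} (i : Fin m) (j : Fin n) : Fin (m * n) :=
  ⟨i.1 * n + j.1, by
    have hj := j.isLt
    calc i.1 * n + j.1 < i.1 * n + n := by omega
      _ = (i.1 + 1) * n := by ring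
      _ ≤ m * n := Nat.mul_le_mul_right n i.isLt⟩

/-- Composition `f ∘ g` on `m·n` variables, applying `g` to each of the `m` blocks
of `n` consecutive coordinates. -/
def compose {m n : ℕ} (f : (Fin m → Bool) → Bool) (g : (Fin n → Bool) → Bool)
    (x : Fin (m * n) → Bool) : Bool :=
  f fun i => g fun j => x (blockIdx i j)

/-- `MAJ₃`: returns `1` (`true`) iff `x₁ + x₂ + x₃ > 0` for `x ∈ {-1,1}³`. -/
def maj3 (x : Fin 3 → Bool) : Bool :=
  decide (0 < (if x 0 then 1 else -1) + (if x 1 then 1 else -1) + (if x 2 then (1 : ℤ) else -1))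

/-- The recursive majority function `MAJ₃^{⊗k}`, with `MAJ₃^{⊗1} = MAJ₃` and
`MAJ₃^{⊗k}` applying `MAJ₃` to `MAJ₃^{⊗(k-1)}` evaluated on the three blocks of
`3^{k-1}` consecutive coordinates. -/
def recMaj : (k : ℕ) → (Fin (3 ^ k) → Bool) → Bool
  | 0, x => x ⟨0, by norm_num⟩
  | k + 1, x => maj3 fun b =>
      recMaj k fun j => x ⟨b.1 * 3 ^ k + j.1, by
        have hb := b.isLt
        have hj := j.isLt
        calc b.1 * 3 ^ k + j.1 < b.1 * 3 ^ k + 3 ^ k := by omega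
          _ = (b.1 + 1) * 3 ^ k := by ring
          _ ≤ 3 * 3 ^ k := Nat.mul_le_mul_right (3 ^ k) hb
          _ = 3 ^ (k + 1) := by ring⟩

/-- A set of inputs is affine if it is closed under sums of three elements, over `𝔽₂`. -/
def IsAffineSet {n : ℕ} (A : Finset (Fin n → Bool)) : Prop :=
  ∀ x ∈ A, ∀ y ∈ A, ∀ z ∈ A, (fun i => xor (x i) (xor (y i) (z i))) ∈ A

/-- A `±1`-valued function which is multiplicative on sums of three elements, over `𝔽₂`. -/
structure IsSignChar {n : ℕ} (φ : (Fin n → Bool) → ℝ) : Prop where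
  sq_eq_one : ∀ x, φ x = 1 ∨ φ x = -1
  map_add : ∀ x y z, φ (fun i => xor (x i) (xor (y i) (z i))) = φ x * φ y * φ z

lemma bsign_eq_one_or (b : Bool) : bsign b = 1 ∨ bsign b = -1 := by
  cases b <;> simp [bsign]

lemma bsign_mul_self (b : Bool) : bsign b * bsign b = 1 := by
  cases b <;> simp [bsign]

lemma bsign_injective : Function.Injective bsign := by
  intro a b h
  cases a <;> cases b <;> simp [bsign] at h ⊢ <;> norm_num at h

lemma bsign_xor (a b c : Bool) : bsign (xor a (xor b c)) = bsign a * bsign b * bsign c := by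
  cases a <;> cases b <;> cases c <;> simp [bsign]

lemma isSignChar_coord {n : ℕ} (i : Fin n) : IsSignChar fun x : Fin n → Bool => bsign (x i) :=
  ⟨fun _ => bsign_eq_one_or _, fun _ _ _ => bsign_xor _ _ _⟩

lemma IsSignChar.mul {n : ℕ} {φ ψ : (Fin n → Bool) → ℝ} (hφ : IsSignChar φ)
    (hψ : IsSignChar ψ) : IsSignChar fun x => φ x * ψ x := by
  refine ⟨fun x => ?_, fun x y z => ?_⟩
  · rcases hφ.sq_eq_one x with h | h <;> rcases hψ.sq_eq_one x with h' | h' <;> simp [h, h']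
  · rw [hφ.map_add, hψ.map_add]; ring

lemma chi_eq_prod_bsign {n : ℕ} (S : Finset (Fin n)) (x : Fin n → Bool) :
    (chi S x : ℝ) = ∏ i ∈ S, bsign (x i) := by
  simp [chi, bsign]

lemma isSignChar_chi {n : ℕ} (S : Finset (Fin n)) : IsSignChar fun x => (chi S x : ℝ) := by
  simp only [chi_eq_prod_bsign]
  induction S using Finset.induction_on with
  | empty => exact ⟨by simp, by simp⟩
  | insert a S ha ih =>
    simp only [Finset.prod_insert ha]
    exact (isSignChar_coord a).mul ih

lemma IsSignChar.sum_eq_zero {n : ℕ} {φ : (Fin n → Bool) → ℝ} (hφ : IsSignChar φ)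
    {A : Finset (Fin n → Bool)} (hA : IsAffineSet A) {y z : Fin n → Bool} (hy : y ∈ A)
    (hz : z ∈ A) (hyz : φ y ≠ φ z) : ∑ x ∈ A, φ x = 0 := by
  have hneg : ∀ x, φ (fun i => xor (x i) (xor (y i) (z i))) = - φ x := by
    intro x
    rw [hφ.map_add]
    rcases hφ.sq_eq_one y with h | h <;> rcases hφ.sq_eq_one z with h' | h' <;>
      simp [h, h'] at hyz ⊢
  refine Finset.sum_involution (fun x _ => fun i => xor (x i) (xor (y i) (z i))) ?_ ?_ ?_ ?_
  · intro x _
    rw [hneg]; ring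
  · intro x _ hx h
    have := hneg x
    rw [h] at this
    exact hx (by linarith)
  · intro x hx
    exact hA x hx y hy z hz
  · intro x _
    funext i
    simp only
    cases x i <;> cases y i <;> cases z i <;> rfl

lemma IsAffineSet.filter_chi {n : ℕ} {A : Finset (Fin n → Bool)} (hA : IsAffineSet A)
    (S : Finset (Fin n)) :
    IsAffineSet (A.filter fun x => chi S x = 1) ∧
      IsAffineSet (A.filter fun x => ¬ chi S x = 1) := by
  have h := isSignChar_chi S
  have hne : ∀ x, ¬ chi S x = 1 ↔ (chi S x : ℝ) = -1 := by
    intro x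
    have h1 : chi S x = 1 ↔ (chi S x : ℝ) = 1 := by norm_cast
    rw [h1]
    rcases h.sq_eq_one x with h' | h' <;> rw [h'] <;> norm_num
  constructor
  · intro x hx y hy z hz
    simp only [mem_filter] at *
    refine ⟨hA x hx.1 y hy.1 z hz.1, ?_⟩
    have := h.map_add x y z
    rw [hx.2, hy.2, hz.2] at this
    exact_mod_cast this
  · intro x hx y hy z hz
    simp only [mem_filter, hne] at *
    refine ⟨hA x hx.1 y hy.1 z hz.1, ?_⟩
    have := h.map_add x y z
    rw [hx.2, hy.2, hz.2] at this
    rw [this]; norm_num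

lemma IsAffineSet.card_filter_chi {n : ℕ} {A : Finset (Fin n → Bool)} (hA : IsAffineSet A)
    (S : Finset (Fin n)) (h₁ : (A.filter fun x => chi S x = 1).Nonempty)
    (h₂ : (A.filter fun x => ¬ chi S x = 1).Nonempty) :
    #(A.filter fun x => chi S x = 1) = #(A.filter fun x => ¬ chi S x = 1) := by
  obtain ⟨y, hy⟩ := h₁
  obtain ⟨z, hz⟩ := h₂
  rw [mem_filter] at hy hz
  have hsum := (isSignChar_chi S).sum_eq_zero hA hy.1 hz.1 (by
    intro h; exact hz.2 (by rw [← hy.2]; exact_mod_cast h.symm))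
  rw [← Finset.sum_filter_add_sum_filter_not A (fun x => chi S x = 1)] at hsum
  rw [Finset.sum_congr rfl (g := fun _ => (1 : ℝ)) (fun x hx => by simp [(mem_filter.1 hx).2]),
    Finset.sum_congr (s₁ := A.filter fun x => ¬ chi S x = 1) rfl (g := fun _ => (-1 : ℝ))
      (fun x hx => by
        have h := (isSignChar_chi S).sq_eq_one x
        have hx' := (mem_filter.1 hx).2
        rcases h with h | h
        · exact absurd (by exact_mod_cast h) hx'
        · exact h)] at hsum
  simp only [sum_const, nsmul_eq_mul, mul_one, mul_neg] at hsum
  have : (#(A.filter fun x => chi S x = 1) : ℝ) = #(A.filter fun x => ¬ chi S x = 1) := by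
    linarith
  exact_mod_cast this

/-- The sum of the coordinates of an input, read as elements of `{-1, 1}`. -/
noncomputable def signSum {n : ℕ} (x : Fin n → Bool) : ℝ := ∑ i, bsign (x i)

/-- The coordinates whose value is not constant on `A`. -/
noncomputable def freeCoords {n : ℕ} (A : Finset (Fin n → Bool)) : Finset (Fin n) := by
  classical
  exact univ.filter fun i => ∃ x ∈ A, ∃ y ∈ A, x i ≠ y i

/-- The coordinates `i` and `j` are equal up to a global sign on `A`. -/
def correlated {n : ℕ} (A : Finset (Fin n → Bool)) : Setoid (Fin n) where
  r i j := ∀ x ∈ A, ∀ y ∈ A, xor (x i) (x j) = xor (y i) (y j)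
  iseqv := by
    refine ⟨fun i x _ y _ => by simp, fun {i j} h x hx y hy => ?_,
      fun {i j l} h h' x hx y hy => ?_⟩
    · rw [Bool.xor_comm, h x hx y hy, Bool.xor_comm]
    · have h₁ := h x hx y hy
      have h₂ := h' x hx y hy
      revert h₁ h₂
      cases x i <;> cases x j <;> cases x l <;> cases y i <;> cases y j <;> cases y l <;> simp

/-- A chosen representative of the class of coordinates correlated to `i` on `A`. -/
noncomputable def rep {n : ℕ} (A : Finset (Fin n → Bool)) (i : Fin n) : Fin n :=
  (Quotient.mk (correlated A) i).out

lemma rep_spec {n : ℕ} (A : Finset (Fin n → Bool)) (i : Fin n) {x y : Fin n → Bool}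
    (hx : x ∈ A) (hy : y ∈ A) :
    xor (x (rep A i)) (x i) = xor (y (rep A i)) (y i) :=
  Quotient.exact (Quotient.out_eq (Quotient.mk (correlated A) i)) x hx y hy

lemma rep_eq_rep {n : ℕ} {A : Finset (Fin n → Bool)} {i j : Fin n}
    (h : ∀ x ∈ A, ∀ y ∈ A, xor (x i) (x j) = xor (y i) (y j)) : rep A i = rep A j := by
  have : Quotient.mk (correlated A) i = Quotient.mk (correlated A) j := Quotient.sound h
  rw [rep, rep, this]

lemma rep_rep {n : ℕ} (A : Finset (Fin n → Bool)) (i : Fin n) : rep A (rep A i) = rep A i :=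
  rep_eq_rep fun _ hx _ hy => rep_spec A i hx hy

lemma rep_mem_freeCoords {n : ℕ} {A : Finset (Fin n → Bool)} {i : Fin n}
    (hi : i ∈ freeCoords A) : rep A i ∈ freeCoords A := by
  classical
  simp only [freeCoords, mem_filter, mem_univ, true_and] at *
  obtain ⟨x, hx, y, hy, hxy⟩ := hi
  refine ⟨x, hx, y, hy, fun h => hxy ?_⟩
  have := rep_spec A i hx hy
  rwa [h, Bool.xor_right_inj] at this

/-- Representatives of the classes of correlated free coordinates. -/
noncomputable def reps {n : ℕ} (A : Finset (Fin n → Bool)) : Finset (Fin n) :=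
  (freeCoords A).image (rep A)

lemma rep_of_mem_reps {n : ℕ} {A : Finset (Fin n → Bool)} {r : Fin n} (hr : r ∈ reps A) :
    rep A r = r ∧ r ∈ freeCoords A := by
  obtain ⟨i, hi, rfl⟩ := mem_image.1 hr
  exact ⟨rep_rep A i, rep_mem_freeCoords hi⟩

lemma card_le_two_pow_card_reps {n : ℕ} (A : Finset (Fin n → Bool)) :
    #A ≤ 2 ^ #(reps A) := by
  classical
  have : #A ≤ #(univ : Finset (reps A → Bool)) := by
    refine Finset.card_le_card_of_injOn (fun x r => x r) (fun _ _ => mem_coe.2 (mem_univ _)) ?_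
    intro x hx y hy hxy
    funext i
    by_cases hi : i ∈ freeCoords A
    · have h₁ := congrFun hxy ⟨rep A i, mem_image_of_mem _ hi⟩
      have h₂ := rep_spec A i hx hy
      simp only at h₁
      rwa [h₁, Bool.xor_right_inj] at h₂
    · by_contra h
      exact hi (by
        simp only [freeCoords, mem_filter, mem_univ, true_and]
        exact ⟨x, hx, y, hy, h⟩)
  simpa using this

lemma sum_bsign_mul_of_mem_reps {n : ℕ} {A : Finset (Fin n → Bool)} (hA : IsAffineSet A)
    {r s : Fin n} (hr : r ∈ reps A) (hs : s ∈ reps A) (hrs : r ≠ s) :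
    ∑ x ∈ A, bsign (x r) * bsign (x s) = 0 := by
  by_contra h
  refine hrs ?_
  rw [← (rep_of_mem_reps hr).1, ← (rep_of_mem_reps hs).1]
  refine rep_eq_rep fun x hx y hy => ?_
  by_contra hne
  refine h (((isSignChar_coord r).mul (isSignChar_coord s)).sum_eq_zero hA hx hy ?_)
  revert hne
  cases x r <;> cases x s <;> cases y r <;> cases y s <;> simp [bsign] <;> norm_num

lemma sum_bsign_of_mem_freeCoords {n : ℕ} {A : Finset (Fin n → Bool)} (hA : IsAffineSet A)
    {i : Fin n} (hi : i ∈ freeCoords A) : ∑ x ∈ A, bsign (x i) = 0 := by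
  simp only [freeCoords, mem_filter, mem_univ, true_and] at hi
  obtain ⟨x, hx, y, hy, hxy⟩ := hi
  exact (isSignChar_coord i).sum_eq_zero hA hx hy fun h => hxy (bsign_injective h)

lemma sum_sq_linear_reps {n : ℕ} {A : Finset (Fin n → Bool)} (hA : IsAffineSet A)
    (w : Fin n → ℝ) :
    ∑ x ∈ A, (∑ r ∈ reps A, w r * bsign (x r)) ^ 2 = #A * ∑ r ∈ reps A, w r ^ 2 := by
  have h : ∀ x : Fin n → Bool, (∑ r ∈ reps A, w r * bsign (x r)) ^ 2 =
      ∑ r ∈ reps A, ∑ s ∈ reps A, w r * w s * (bsign (x r) * bsign (x s)) := by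
    intro x
    rw [sq, Finset.sum_mul_sum]
    exact Finset.sum_congr rfl fun r _ => Finset.sum_congr rfl fun s _ => by ring
  simp only [h]
  rw [Finset.sum_comm, Finset.mul_sum]
  refine Finset.sum_congr rfl fun r hr => ?_
  rw [Finset.sum_comm, Finset.sum_eq_single_of_mem r hr]
  · simp only [bsign_mul_self, sum_const, nsmul_eq_mul]; ring
  · intro s hs hsr
    rw [← Finset.mul_sum, sum_bsign_mul_of_mem_reps hA hr hs hsr.symm, mul_zero]

/-- The free coordinates contribute at least `2 * #(reps A) - n` to the second moment. -/
lemma sum_sq_freeCoords_ge {n : ℕ} {A : Finset (Fin n → Bool)} (hA : IsAffineSet A)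
    (hne : A.Nonempty) :
    (#A : ℝ) * (2 * #(reps A) - n) ≤ ∑ x ∈ A, (∑ i ∈ freeCoords A, bsign (x i)) ^ 2 := by
  classical
  obtain ⟨z, hz⟩ := hne
  let σ : Fin n → ℝ := fun i => bsign (z (rep A i)) * bsign (z i)
  let fiber : Fin n → Finset (Fin n) := fun r => (freeCoords A).filter fun i => rep A i = r
  let w : Fin n → ℝ := fun r => ∑ i ∈ fiber r, σ i
  have hσ : ∀ x ∈ A, ∀ i, bsign (x i) = σ i * bsign (x (rep A i)) := by
    intro x hx i
    have := rep_spec A i hx hz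
    simp only [σ]
    revert this
    cases x i <;> cases x (rep A i) <;> cases z i <;> cases z (rep A i) <;> simp [bsign]
  have hmaps : ∀ i ∈ freeCoords A, rep A i ∈ reps A := fun i hi => mem_image_of_mem _ hi
  have hlin : ∀ x ∈ A, ∑ i ∈ freeCoords A, bsign (x i) = ∑ r ∈ reps A, w r * bsign (x r) := by
    intro x hx
    rw [← Finset.sum_fiberwise_of_maps_to hmaps]
    refine Finset.sum_congr rfl fun r _ => ?_
    rw [Finset.sum_mul]
    refine Finset.sum_congr rfl fun i hi => ?_
    rw [hσ x hx i, (mem_filter.1 hi).2]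
  rw [Finset.sum_congr rfl fun x hx => by rw [hlin x hx], sum_sq_linear_reps hA]
  refine mul_le_mul_of_nonneg_left ?_ (Nat.cast_nonneg _)
  have hcard : ∑ r ∈ reps A, #(fiber r) ≤ n := by
    rw [← Finset.card_eq_sum_card_fiberwise hmaps]
    simpa using Finset.card_le_univ (freeCoords A)
  have hcard' : ∑ r ∈ reps A, (#(fiber r) : ℝ) ≤ n := by exact_mod_cast hcard
  have htwo : ∀ r ∈ reps A, (2 : ℝ) ≤ #(fiber r) + w r ^ 2 := by
    intro r hr
    have hmem : r ∈ fiber r := mem_filter.2 ⟨(rep_of_mem_reps hr).2, (rep_of_mem_reps hr).1⟩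
    rcases Nat.lt_or_ge 1 #(fiber r) with h | h
    · have : (2 : ℝ) ≤ #(fiber r) := by exact_mod_cast h
      nlinarith [sq_nonneg (w r)]
    · have h₁ : #(fiber r) = 1 := le_antisymm h (Finset.card_pos.2 ⟨r, hmem⟩)
      have h₂ : fiber r = {r} :=
        (Finset.eq_singleton_or_nontrivial hmem).resolve_right fun hn =>
          absurd (Finset.one_lt_card_iff_nontrivial.2 hn) (by omega)
      have h₃ : w r = 1 := by
        simp only [w, h₂, sum_singleton, σ, (rep_of_mem_reps hr).1, bsign_mul_self]
      rw [h₁, h₃]; norm_num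
  have := Finset.sum_le_sum htwo
  rw [Finset.sum_add_distrib, sum_const, nsmul_eq_mul] at this
  linarith

/-- On an affine set of codimension at most `d`, the squared mean of the coordinate sum exceeds
the mean of `signSum ^ 2 - n` by at most `2 * d`. -/
lemma sq_sum_signSum_le {n d : ℕ} {A : Finset (Fin n → Bool)} (hA : IsAffineSet A)
    (hne : A.Nonempty) (hd : 2 ^ n ≤ #A * 2 ^ d) :
    (∑ x ∈ A, signSum x) ^ 2 ≤ #A * ∑ x ∈ A, (2 * (d : ℝ) + signSum x ^ 2 - n) := by
  classical
  have hreps : n ≤ #(reps A) + d := by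
    have : 2 ^ n ≤ 2 ^ (#(reps A) + d) := by
      rw [pow_add]
      exact hd.trans (Nat.mul_le_mul_right _ (card_le_two_pow_card_reps A))
    exact (Nat.pow_le_pow_iff_right (by norm_num)).1 this
  have hreps' : (n : ℝ) ≤ #(reps A) + d := by exact_mod_cast hreps
  obtain ⟨z, hz⟩ := hne
  set c : ℝ := ∑ i ∈ (freeCoords A)ᶜ, bsign (z i) with hc
  let u : (Fin n → Bool) → ℝ := fun x => ∑ i ∈ freeCoords A, bsign (x i)
  have hsplit : ∀ x ∈ A, signSum x = c + u x := by
    intro x hx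
    rw [signSum, ← Finset.sum_compl_add_sum (freeCoords A)]
    congr 1
    refine Finset.sum_congr rfl fun i hi => ?_
    have hi' : ¬ i ∈ freeCoords A := mem_compl.1 hi
    simp only [freeCoords, mem_filter, mem_univ, true_and] at hi'
    push Not at hi'
    rw [hi' x hx z hz]
  have hu : ∑ x ∈ A, u x = 0 := by
    rw [Finset.sum_comm]
    exact Finset.sum_eq_zero fun i hi => sum_bsign_of_mem_freeCoords hA hi
  have hu2 : (#A : ℝ) * (2 * #(reps A) - n) ≤ ∑ x ∈ A, u x ^ 2 := sum_sq_freeCoords_ge hA ⟨z, hz⟩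
  have h₁ : ∑ x ∈ A, signSum x = #A * c := by
    rw [Finset.sum_congr rfl hsplit, Finset.sum_add_distrib, hu]; simp
  have h₂ : ∑ x ∈ A, (2 * (d : ℝ) + signSum x ^ 2 - n) =
      #A * (2 * d - n + c ^ 2) + ∑ x ∈ A, u x ^ 2 := by
    have : ∀ x ∈ A, (2 * (d : ℝ) + signSum x ^ 2 - n) =
        (2 * d - n + c ^ 2) + 2 * c * u x + u x ^ 2 := by
      intro x hx
      rw [hsplit x hx]; ring
    rw [Finset.sum_congr rfl this, Finset.sum_add_distrib, Finset.sum_add_distrib,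
      ← Finset.mul_sum, hu, sum_const, nsmul_eq_mul, mul_zero, add_zero]
  rw [h₁, h₂]
  have hm : (0 : ℝ) ≤ #A := Nat.cast_nonneg _
  have h₃ : 0 ≤ (#A : ℝ) * (2 * d - n) + ∑ x ∈ A, u x ^ 2 := by nlinarith
  nlinarith [mul_nonneg hm h₃]

lemma PDT.sum_eval_mul_signSum_le {n : ℕ} (a : ℝ) (d : ℕ) (T : PDT n) :
    ∀ (A : Finset (Fin n → Bool)) (e : ℕ), IsAffineSet A → 2 ^ n ≤ #A * 2 ^ e →
      e + T.depth ≤ d →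
      ∑ x ∈ A, 2 * a * (bsign (T.eval x) * signSum x) ≤
        ∑ x ∈ A, (a ^ 2 + (2 * (d : ℝ) + signSum x ^ 2 - n)) := by
  induction T with
  | leaf b =>
    intro A e hA hcard hde
    have hd : e ≤ d := by simpa [PDT.depth] using hde
    have hne : A.Nonempty := by
      rw [Finset.nonempty_iff_ne_empty]
      rintro rfl
      simp at hcard
    have hm : (0 : ℝ) < #A := by exact_mod_cast Finset.card_pos.2 hne
    have key := sq_sum_signSum_le (d := d) hA hne
      (hcard.trans (Nat.mul_le_mul_left _ (Nat.pow_le_pow_right (by norm_num) hd)))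
    simp only [PDT.eval]
    rw [Finset.sum_add_distrib, ← Finset.mul_sum, ← Finset.mul_sum, sum_const, nsmul_eq_mul]
    set s := ∑ x ∈ A, signSum x
    have hb := bsign_mul_self b
    refine le_of_mul_le_mul_left ?_ hm
    nlinarith [sq_nonneg (#A * a - bsign b * s)]
  | node S t0 t1 ih0 ih1 =>
    intro A e hA hcard hde
    simp only [PDT.depth] at hde
    have hd0 : e + 1 + t0.depth ≤ d := by have := le_max_left t0.depth t1.depth; omega
    have hd1 : e + 1 + t1.depth ≤ d := by have := le_max_right t0.depth t1.depth; omega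
    have haff := hA.filter_chi S
    have hcs := Finset.card_filter_add_card_filter_not (s := A) (fun x => chi S x = 1)
    have half : ∀ B : Finset (Fin n → Bool), #A ≤ 2 * #B → 2 ^ n ≤ #B * 2 ^ (e + 1) := by
      intro B hB
      calc 2 ^ n ≤ #A * 2 ^ e := hcard
        _ ≤ 2 * #B * 2 ^ e := Nat.mul_le_mul_right _ hB
        _ = #B * 2 ^ (e + 1) := by ring
    rw [← Finset.sum_filter_add_sum_filter_not A (fun x => chi S x = 1),
      ← Finset.sum_filter_add_sum_filter_not A (fun x => chi S x = 1)
        (fun x => a ^ 2 + (2 * (d : ℝ) + signSum x ^ 2 - n))]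
    refine add_le_add ?_ ?_
    · rcases (A.filter fun x => chi S x = 1).eq_empty_or_nonempty with h | h
      · simp [h]
      have hB : #A ≤ 2 * #(A.filter fun x => chi S x = 1) := by
        rcases (A.filter fun x => ¬ chi S x = 1).eq_empty_or_nonempty with h' | h'
        · rw [h', card_empty] at hcs; omega
        · have := hA.card_filter_chi S h h'; omega
      refine le_trans (le_of_eq ?_) (ih1 _ (e + 1) haff.1 (half _ hB) hd1)
      refine Finset.sum_congr rfl fun x hx => ?_
      rw [PDT.eval, if_pos (mem_filter.1 hx).2]
    · rcases (A.filter fun x => ¬ chi S x = 1).eq_empty_or_nonempty with h | h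
      · simp [h]
      have hB : #A ≤ 2 * #(A.filter fun x => ¬ chi S x = 1) := by
        rcases (A.filter fun x => chi S x = 1).eq_empty_or_nonempty with h' | h'
        · rw [h', card_empty] at hcs; omega
        · have := hA.card_filter_chi S h' h; omega
      refine le_trans (le_of_eq ?_) (ih0 _ (e + 1) haff.2 (half _ hB) hd0)
      refine Finset.sum_congr rfl fun x hx => ?_
      rw [PDT.eval, if_neg (mem_filter.1 hx).2]

lemma isAffineSet_univ {n : ℕ} : IsAffineSet (univ : Finset (Fin n → Bool)) :=
  fun _ _ _ _ _ _ => mem_univ _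

lemma sum_signSum_sq (n : ℕ) :
    ∑ x : Fin n → Bool, signSum x ^ 2 = 2 ^ n * (n : ℝ) := by
  have h : ∀ x : Fin n → Bool, signSum x ^ 2 = ∑ i, ∑ j, bsign (x i) * bsign (x j) := by
    intro x; rw [signSum, sq, Finset.sum_mul_sum]
  simp only [h]
  rw [Finset.sum_comm]
  have : ∀ i : Fin n, ∑ x : Fin n → Bool, ∑ j, bsign (x i) * bsign (x j) = 2 ^ n := by
    intro i
    rw [Finset.sum_comm, Finset.sum_eq_single i]
    · simp [bsign_mul_self]
    · intro j _ hji
      refine ((isSignChar_coord i).mul (isSignChar_coord j)).sum_eq_zero isAffineSet_univ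
        (mem_univ (fun _ => true)) (mem_univ (Function.update (fun _ => true) j false)) ?_
      simp [Function.update_of_ne hji.symm, bsign]
      norm_num
    · simp
  simp [this, mul_comm]

/-- If a parity decision tree of depth `d` computes `f`, then the sum of the linear Fourier
coefficients of `f` is at most `√(2 d)`. -/
lemma PDT.Computes.sq_le_two_mul_depth {n : ℕ} {T : PDT n} {f : (Fin n → Bool) → Bool}
    (hT : T.Computes f) {a : ℝ}
    (hf : ∑ x, bsign (f x) * signSum x = 2 ^ n * a) : a ^ 2 ≤ 2 * T.depth := by
  have h := PDT.sum_eval_mul_signSum_le a T.depth T univ 0 isAffineSet_univ (by simp) (by simp)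
  simp only [hT _] at h
  rw [← Finset.mul_sum, hf] at h
  have h' : ∑ x : Fin n → Bool, (a ^ 2 + (2 * (T.depth : ℝ) + signSum x ^ 2 - n)) =
      2 ^ n * (a ^ 2 + 2 * T.depth) := by
    have : ∀ x : Fin n → Bool, a ^ 2 + (2 * (T.depth : ℝ) + signSum x ^ 2 - n) =
        (a ^ 2 + 2 * T.depth - n) + signSum x ^ 2 := fun x => by ring
    simp only [this]
    rw [Finset.sum_add_distrib, sum_signSum_sq]
    simp
    ring
  rw [h'] at h
  have h2 : (0 : ℝ) < 2 ^ n := by positivity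
  refine le_of_mul_le_mul_left ?_ h2
  linarith

/-- Splitting an input of `MAJ₃^{⊗(k+1)}` into three blocks. -/
def blockEquiv (k : ℕ) : Fin 3 × Fin (3 ^ k) ≃ Fin (3 ^ (k + 1)) :=
  finProdFinEquiv.trans (finCongr (by ring))

/-- Inputs of `MAJ₃^{⊗(k+1)}` are triples of inputs of `MAJ₃^{⊗k}`. -/
def inputEquiv (k : ℕ) : (Fin (3 ^ (k + 1)) → Bool) ≃ (Fin 3 → Fin (3 ^ k) → Bool) :=
  ((blockEquiv k).symm.arrowCongr (Equiv.refl Bool)).trans (Equiv.curry _ _ _)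

lemma recMaj_succ_symm (k : ℕ) (y : Fin 3 → Fin (3 ^ k) → Bool) :
    recMaj (k + 1) ((inputEquiv k).symm y) = maj3 fun b => recMaj k (y b) := by
  obtain ⟨x, rfl⟩ := (inputEquiv k).surjective y
  rw [Equiv.symm_apply_apply, recMaj]
  congr 1
  funext b
  congr 1
  funext j
  simp only [inputEquiv, Equiv.trans_apply, Equiv.curry_apply, Function.curry,
    Equiv.arrowCongr_apply, Function.comp, Equiv.symm_symm, Equiv.refl_apply]
  congr 1
  ext
  simp [blockEquiv, finProdFinEquiv]
  ring

lemma signSum_symm (k : ℕ) (y : Fin 3 → Fin (3 ^ k) → Bool) :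
    signSum ((inputEquiv k).symm y) = ∑ b, signSum (y b) := by
  obtain ⟨x, rfl⟩ := (inputEquiv k).surjective y
  rw [Equiv.symm_apply_apply]
  simp only [signSum]
  rw [← (blockEquiv k).sum_comp, Fintype.sum_prod_type]
  rfl

lemma bsign_maj3 (b : Fin 3 → Bool) :
    bsign (maj3 b) = (bsign (b 0) + bsign (b 1) + bsign (b 2)
      - bsign (b 0) * bsign (b 1) * bsign (b 2)) / 2 := by
  simp only [maj3]
  cases b 0 <;> cases b 1 <;> cases b 2 <;> norm_num [bsign]

lemma sum_triple {X : Type*} [Fintype X] (g₀ g₁ g₂ : X → ℝ) :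
    ∑ y : Fin 3 → X, g₀ (y 0) * g₁ (y 1) * g₂ (y 2) =
      (∑ x, g₀ x) * (∑ x, g₁ x) * ∑ x, g₂ x := by
  classical
  have := Finset.prod_univ_sum (fun _ : Fin 3 => (univ : Finset X)) (fun i => ![g₀, g₁, g₂] i)
  simp only [Fin.prod_univ_three, Fintype.piFinset_univ] at this
  exact this.symm

lemma sum_bsign_recMaj (k : ℕ) : ∑ x, bsign (recMaj k x) = 0 := by
  induction k with
  | zero =>
    exact (isSignChar_coord _).sum_eq_zero isAffineSet_univ (mem_univ (fun _ => true))
      (mem_univ (fun _ => false)) (by norm_num [bsign])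
  | succ k ih =>
    rw [← (inputEquiv k).symm.sum_comp]
    simp only [recMaj_succ_symm, bsign_maj3]
    let f : (Fin (3 ^ k) → Bool) → ℝ := fun x => bsign (recMaj k x)
    have h₀ := sum_triple f (fun _ => 1) (fun _ => 1)
    have h₁ := sum_triple (fun _ => 1) f (fun _ => 1)
    have h₂ := sum_triple (fun _ => 1) (fun _ => 1) f
    have h₃ := sum_triple f f f
    simp only [f, ih, mul_one, one_mul, zero_mul, mul_zero] at h₀ h₁ h₂ h₃
    rw [← Finset.sum_div, Finset.sum_sub_distrib, Finset.sum_add_distrib, Finset.sum_add_distrib,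
      h₀, h₁, h₂, h₃]
    norm_num

lemma sum_bsign_recMaj_mul_signSum (k : ℕ) :
    ∑ x, bsign (recMaj k x) * signSum x = 2 ^ 3 ^ k * (3 / 2 : ℝ) ^ k := by
  induction k with
  | zero =>
    have : ∀ x : Fin (3 ^ 0) → Bool, bsign (recMaj 0 x) * signSum x = 1 := by
      intro x
      have : signSum x = bsign (recMaj 0 x) := Fin.sum_univ_one fun i => bsign (x i)
      rw [this, bsign_mul_self]
    simp [this]
  | succ k ih =>
    rw [← (inputEquiv k).symm.sum_comp]
    simp only [recMaj_succ_symm, bsign_maj3, signSum_symm]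
    let f : (Fin (3 ^ k) → Bool) → ℝ := fun x => bsign (recMaj k x)
    let s : (Fin (3 ^ k) → Bool) → ℝ := signSum
    let o : (Fin (3 ^ k) → Bool) → ℝ := fun _ => 1
    have hf : ∑ x, f x = 0 := sum_bsign_recMaj k
    have hfs : ∑ x, f x * s x = 2 ^ 3 ^ k * (3 / 2 : ℝ) ^ k := ih
    have ho : ∑ x, o x = 2 ^ 3 ^ k := by simp [o]
    have expand : ∀ y : Fin 3 → Fin (3 ^ k) → Bool,
        (bsign (recMaj k (y 0)) + bsign (recMaj k (y 1)) + bsign (recMaj k (y 2))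
          - bsign (recMaj k (y 0)) * bsign (recMaj k (y 1)) * bsign (recMaj k (y 2))) / 2
          * ∑ b, signSum (y b) =
        ((f (y 0) * s (y 0)) * o (y 1) * o (y 2) + f (y 0) * s (y 1) * o (y 2)
          + f (y 0) * o (y 1) * s (y 2)
          + s (y 0) * f (y 1) * o (y 2) + o (y 0) * (f (y 1) * s (y 1)) * o (y 2)
          + o (y 0) * f (y 1) * s (y 2)
          + s (y 0) * o (y 1) * f (y 2) + o (y 0) * s (y 1) * f (y 2)
          + o (y 0) * o (y 1) * (f (y 2) * s (y 2))
          - (f (y 0) * s (y 0)) * f (y 1) * f (y 2) - f (y 0) * (f (y 1) * s (y 1)) * f (y 2)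
          - f (y 0) * f (y 1) * (f (y 2) * s (y 2))) / 2 := by
      intro y
      rw [Fin.sum_univ_three]
      simp only [f, s, o]
      ring
    simp only [expand]
    rw [← Finset.sum_div]
    simp only [Finset.sum_sub_distrib, Finset.sum_add_distrib]
    rw [sum_triple (fun x => f x * s x) o o, sum_triple f s o, sum_triple f o s,
      sum_triple s f o, sum_triple o (fun x => f x * s x) o, sum_triple o f s,
      sum_triple s o f, sum_triple o s f, sum_triple o o (fun x => f x * s x),
      sum_triple (fun x => f x * s x) f f, sum_triple f (fun x => f x * s x) f,
      sum_triple f f (fun x => f x * s x), hf, hfs, ho]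
    rw [pow_succ 3 k, pow_mul, pow_succ (3 / 2 : ℝ) k]
    ring

/-- **Theorem.** For every `k ≥ 1`, every parity decision tree computing the recursive
majority function `MAJ₃^{⊗k}` has depth at least `(9/4)^k / (4·ln 2) = Ω(2.25^k)`. -/
theorem recMaj_pdt_depth_lower_bound (k : ℕ) (hk : 1 ≤ k) (T : PDT (3 ^ k))
    (hT : T.Computes (recMaj k)) :
    (9 / 4 : ℝ) ^ k / (4 * Real.log 2) ≤ (T.depth : ℝ) := by
  have h := hT.sq_le_two_mul_depth (sum_bsign_recMaj_mul_signSum k)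
  rw [← pow_mul, mul_comm k 2, pow_mul] at h
  have hlog : (1 / 2 : ℝ) < Real.log 2 := by linarith [Real.log_two_gt_d9]
  rw [div_le_iff₀ (by linarith)]
  have hd : (0 : ℝ) ≤ T.depth := Nat.cast_nonneg _
  norm_num at h
  nlinarith
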